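/- Let G be a finite group and g ∈ G. Then the number of solutions (x,y) ∈ G × G of xyx⁻¹y⁻¹ = g equals Σ_{χ ∈ Irr(G)} (|G|/χ(1))·χ(g), and this function of g is a character of G. -/

import Mathlib

open CategoryTheory

/-- The number of solutions `(x, y) ∈ G × G` of `x * y * x⁻¹ * y⁻¹ = g`. -/
noncomputable def commutatorCount (G : Type) [Group G] (g : G) : ℕ :=
  Nat.card {p : G × G // p.1 * p.2 * p.1⁻¹ * p.2⁻¹ = g}

namespace Representation

variable {k G V W : Type*} [Monoid G] [Field k] [AddCommGroup V] [Module k V]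
  [FiniteDimensional k V] [AddCommGroup W] [Module k W] [FiniteDimensional k W]

lemma char_prod (ρ : Representation k G V) (σ : Representation k G W) :
    (ρ.prod σ).character = ρ.character + σ.character :=
  funext fun g => LinearMap.trace_prodMap' (ρ g) (σ g)

lemma char_eq_add_of_isCompl (ρ : Representation k G V) {p q : Subrepresentation ρ}
    (h : IsCompl p.toSubmodule q.toSubmodule) :
    ρ.character = p.toRepresentation.character + q.toRepresentation.character := by
  rw [← char_prod]
  symm
  ext g
  have hconj : ρ g = (Submodule.prodEquivOfIsCompl _ _ h).conj
      ((p.toRepresentation.prod q.toRepresentation) g) := by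
    refine LinearMap.ext fun x => ?_
    obtain ⟨⟨a, b⟩, rfl⟩ := (Submodule.prodEquivOfIsCompl _ _ h).surjective x
    rw [LinearEquiv.conj_apply_apply, LinearEquiv.symm_apply_apply]
    simp [Representation.prod, Subrepresentation.toRepresentation]
  rw [character, character, hconj, LinearMap.trace_conj']

end Representation

section SimpleDecomposition

variable {G : Type} [Group G] [Fintype G]

lemma FDRep.simple_of_isIrreducible {V : Type} [AddCommGroup V] [Module ℂ V]
    [FiniteDimensional ℂ V] (ρ : Representation ℂ G V) [ρ.IsIrreducible] :
    Simple (FDRep.of ρ) := by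
  rw [FDRep.simple_iff_char_is_norm_one]
  have := invertibleOfNonzero (NeZero.ne (Nat.card G : ℂ))
  have h := Representation.char_orthonormal ρ ρ
  rw [if_pos ⟨.refl ρ⟩, inv_mul_eq_one₀ (NeZero.ne _)] at h
  exact h.symm

/-- Characters are sums of irreducible characters. -/
lemma Representation.char_mem_closure_simple {V : Type} [AddCommGroup V] [Module ℂ V]
    [FiniteDimensional ℂ V] (ρ : Representation ℂ G V) :
    ρ.character ∈ AddSubmonoid.closure
      {χ : G → ℂ | ∃ W : FDRep ℂ G, Simple W ∧ W.character = χ} := by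
  induction hn : Module.finrank ℂ V using Nat.strong_induction_on generalizing V with
  | _ n ih =>
  subst hn
  by_cases hirr : ρ.IsIrreducible
  · exact AddSubmonoid.subset_closure ⟨FDRep.of ρ, FDRep.simple_of_isIrreducible ρ, rfl⟩
  · rcases subsingleton_or_nontrivial V with hV | hV
    · have : ρ.character = 0 := by
        ext g
        rw [Representation.character, Subsingleton.elim (ρ g) 0, map_zero, Pi.zero_apply]
      rw [this]
      exact zero_mem _
    · have : Nontrivial (Subrepresentation ρ) := by
        refine ⟨⊥, ⊤, fun h => ?_⟩
        exact bot_ne_top (α := Submodule ℂ V) (congrArg Subrepresentation.toSubmodule h)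
      obtain ⟨p, hp0, hp1⟩ : ∃ p : Subrepresentation ρ, p ≠ ⊥ ∧ p ≠ ⊤ := by
        by_contra! h
        exact hirr ⟨fun p => or_iff_not_imp_left.2 (h p)⟩
      have hss : ρ.IsSemisimpleRepresentation :=
        ρ.isSemisimpleRepresentation_iff_isSemisimpleModule_asModule.2 inferInstance
      obtain ⟨q, hpq⟩ := hss.exists_isCompl p
      have hc : IsCompl p.toSubmodule q.toSubmodule :=
        ⟨disjoint_iff.2 (congrArg Subrepresentation.toSubmodule hpq.inf_eq_bot),
          codisjoint_iff.2 (congrArg Subrepresentation.toSubmodule hpq.sup_eq_top)⟩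
      have hq1 : q.toSubmodule ≠ ⊤ := fun h => hp0 <| Subrepresentation.toSubmodule_injective <|
        by
        rw [h] at hc
        exact (inf_top_eq _).symm.trans hc.inf_eq_bot
      rw [ρ.char_eq_add_of_isCompl hc]
      exact add_mem
        (ih _ (Submodule.finrank_lt fun h => hp1 (Subrepresentation.toSubmodule_injective h)) _ rfl)
        (ih _ (Submodule.finrank_lt hq1) _ rfl)

end SimpleDecomposition

namespace FDRep

variable {G : Type} [Group G] [Fintype G] (V : FDRep ℂ G) [Simple V]

omit [Fintype G] in
/-- Schur's lemma, with the scalar computed by the trace. -/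
lemma eq_trace_div_smul_one_of_commute (T : V →ₗ[ℂ] V) (hT : ∀ g, Commute (V.ρ g) T)
    (hd : (Module.finrank ℂ V : ℂ) ≠ 0) :
    T = (LinearMap.trace ℂ V T / Module.finrank ℂ V) • (1 : V →ₗ[ℂ] V) := by
  let f : V ⟶ V := ⟨InducedCategory.homMk (ModuleCat.ofHom T), fun g => by
    ext1
    exact (hT g).symm.eq⟩
  obtain ⟨c, hc⟩ := endomorphism_simple_eq_smul_id ℂ f
  have hcT : c • (1 : V →ₗ[ℂ] V) = T := congrArg (fun f : V ⟶ V => f.hom.hom.hom) hc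
  rw [← hcT, map_smul, LinearMap.trace_one, smul_eq_mul, mul_div_cancel_right₀ _ hd]

lemma finrank_ne_zero_of_simple : (Module.finrank ℂ V : ℂ) ≠ 0 := by
  intro h
  have : Subsingleton V := Module.finrank_zero_iff.1 (Nat.cast_eq_zero.1 h)
  have h0 (g : G) : V.character g = 0 := by
    rw [FDRep.character, Subsingleton.elim (V.ρ g) 0, map_zero]
  have := (simple_iff_char_is_norm_one V).1 inferInstance
  simp only [h0, mul_zero, Finset.sum_const_zero] at this
  exact NeZero.ne (Nat.card G : ℂ) this.symm

/-- The sum of the operators of a simple representation over the conjugates of `y`. -/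
lemma sum_conj_ρ (y : G) :
    ∑ x : G, V.ρ (x * y * x⁻¹) =
      (Nat.card G * V.character y / Module.finrank ℂ V : ℂ) • (1 : V →ₗ[ℂ] V) := by
  rw [V.eq_trace_div_smul_one_of_commute (∑ x : G, V.ρ (x * y * x⁻¹)) _
    V.finrank_ne_zero_of_simple]
  · congr 2
    rw [map_sum]
    refine (Finset.sum_congr rfl fun x _ => V.char_conj y x).trans ?_
    simp
  · intro g
    rw [commute_iff_eq, Finset.mul_sum, Finset.sum_mul, ← Equiv.sum_comp (Equiv.mulLeft g)
      fun x => V.ρ (x * y * x⁻¹) * V.ρ g]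
    refine Finset.sum_congr rfl fun x _ => ?_
    rw [← map_mul, ← map_mul]
    congr 1
    simp [mul_assoc]

/-- The sum of the operators of a simple representation over all commutators. -/
lemma sum_commutator_ρ :
    ∑ y : G, ∑ x : G, V.ρ (x * y * x⁻¹ * y⁻¹) =
      (Nat.card G / Module.finrank ℂ V : ℂ) ^ 2 • (1 : V →ₗ[ℂ] V) := by
  have hd := V.finrank_ne_zero_of_simple
  rw [V.eq_trace_div_smul_one_of_commute (∑ y : G, ∑ x : G, V.ρ (x * y * x⁻¹ * y⁻¹)) _ hd]
  · have h := (simple_iff_char_is_norm_one V).1 inferInstance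
    have key : ∑ y : G, ∑ x : G, V.ρ (x * y * x⁻¹ * y⁻¹) =
        ∑ y : G, (Nat.card G * V.character y / Module.finrank ℂ V : ℂ) • V.ρ y⁻¹ := by
      refine Finset.sum_congr rfl fun y _ => ?_
      simp_rw [map_mul V.ρ _ y⁻¹]
      rw [← Finset.sum_mul, sum_conj_ρ, smul_mul_assoc, one_mul]
    congr 1
    rw [key, map_sum]
    simp_rw [map_smul, smul_eq_mul]
    have hsum : ∑ y : G, (Nat.card G * V.character y / Module.finrank ℂ V : ℂ) *
        LinearMap.trace ℂ V (V.ρ y⁻¹) =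
        Nat.card G / Module.finrank ℂ V * ∑ y : G, V.character y * V.character y⁻¹ := by
      rw [Finset.mul_sum]
      refine Finset.sum_congr rfl fun y _ => ?_
      rw [FDRep.character, FDRep.character]
      ring
    rw [hsum, h]
    ring
  · intro g
    rw [commute_iff_eq, Finset.mul_sum, Finset.sum_mul, ← Equiv.sum_comp (MulAut.conj g).toEquiv
      fun y => (∑ x : G, V.ρ (x * y * x⁻¹ * y⁻¹)) * V.ρ g]
    refine Finset.sum_congr rfl fun y _ => ?_
    rw [Finset.mul_sum, Finset.sum_mul, ← Equiv.sum_comp (MulAut.conj g).toEquiv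
      fun x => V.ρ (x * _ * x⁻¹ * _) * V.ρ g]
    refine Finset.sum_congr rfl fun x _ => ?_
    rw [← map_mul, ← map_mul]
    congr 1
    simp [mul_assoc]

/-- The dimension of a simple complex representation divides the order of the group. -/
lemma finrank_dvd_card : Module.finrank ℂ V ∣ Nat.card G := by
  have hd := V.finrank_ne_zero_of_simple
  have : Nontrivial V := Module.nontrivial_of_finrank_pos
    (R := ℂ) (Nat.pos_of_ne_zero (by exact_mod_cast hd))
  have hz : IsIntegral ℤ
      (∑ y : G, ∑ x : G, MonoidAlgebra.single (x * y * x⁻¹ * y⁻¹) (1 : ℤ)) :=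
    Algebra.IsIntegral.isIntegral _
  have hsq := hz.map (MonoidAlgebra.lift ℤ (V →ₗ[ℂ] V) G V.ρ)
  simp only [map_sum, MonoidAlgebra.lift_single, one_smul, sum_commutator_ρ] at hsq
  rw [← Algebra.algebraMap_eq_smul_one, isIntegral_algebraMap_iff
    (FaithfulSMul.algebraMap_injective ℂ (V →ₗ[ℂ] V))] at hsq
  have hq : IsIntegral ℤ ((Nat.card G : ℚ) / Module.finrank ℂ V) := by
    rw [← isIntegral_algebraMap_iff (algebraMap ℚ ℂ).injective]
    simpa using hsq.of_pow two_pos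
  obtain ⟨m, hm⟩ := IsIntegrallyClosed.isIntegral_iff.1 hq
  have hd' : (Module.finrank ℂ V : ℚ) ≠ 0 := by exact_mod_cast hd
  rw [eq_div_iff hd'] at hm
  refine Int.natCast_dvd_natCast.1 ⟨m, ?_⟩
  rw [mul_comm]
  rw [eq_intCast] at hm
  exact_mod_cast hm.symm

end FDRep

section CompleteFamily

variable {G : Type} [Group G] [Fintype G] {ι : Type} [Fintype ι] {V : ι → FDRep ℂ G}

/-- The column orthogonality relation with the identity: the multiplicity of each irreducible
character in the regular character is its degree. -/
lemma sum_finrank_mul_char (hsimple : ∀ i, Simple (V i))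
    (hdistinct : ∀ i j, Nonempty (V i ≅ V j) → i = j)
    (hcomplete : ∀ W : FDRep ℂ G, Simple W → ∃ i, Nonempty (W ≅ V i)) [DecidableEq G] (g : G) :
    ∑ i, (Module.finrank ℂ (V i) : ℂ) * (V i).character g =
      if g = 1 then (Nat.card G : ℂ) else 0 := by
  classical
  have := invertibleOfNonzero (NeZero.ne (Nat.card G : ℂ))
  let reg : G → ℂ := fun g => if g = 1 then (Nat.card G : ℂ) else 0
  have hreg : (Representation.ofMulAction ℂ G G).character = reg := by
    ext g
    rw [Representation.character,
      LinearMap.trace_eq_matrix_trace ℂ (MonoidAlgebra.basis G ℂ)]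
    simp_rw [Matrix.trace, Matrix.diag, LinearMap.toMatrix_apply, MonoidAlgebra.basis_apply,
      Representation.ofMulAction_single, ← MonoidAlgebra.basis_apply, Module.Basis.repr_self,
      Finsupp.single_apply, smul_eq_mul, mul_eq_right, reg]
    split_ifs <;> simp
  have hspan : reg ∈ Submodule.span ℂ (Set.range fun i => (V i).character) := by
    rw [← hreg]
    have hmem := (Representation.ofMulAction ℂ G G).char_mem_closure_simple
    refine (AddSubmonoid.closure_le (S := (Submodule.span ℂ _).toAddSubmonoid)).2 ?_ hmem
    rintro _ ⟨W, hW, rfl⟩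
    obtain ⟨i, ⟨e⟩⟩ := hcomplete W hW
    exact Submodule.subset_span ⟨i, (FDRep.char_iso e).symm⟩
  obtain ⟨c, hc⟩ := (Submodule.mem_span_range_iff_exists_fun ℂ).1 hspan
  have hcoef (j : ι) : c j = Module.finrank ℂ (V j) := by
    have h1 : (Nat.card G : ℂ)⁻¹ * ∑ g : G, reg g * (V j).character g⁻¹ =
        Module.finrank ℂ (V j) := by
      simp [reg, ite_mul]
    have h2 : (Nat.card G : ℂ)⁻¹ * ∑ g : G, reg g * (V j).character g⁻¹ =
        ∑ i, c i * ((Nat.card G : ℂ)⁻¹ * ∑ g : G, (V i).character g * (V j).character g⁻¹) := by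
      simp_rw [← hc, Finset.sum_apply, Pi.smul_apply, smul_eq_mul, Finset.sum_mul,
        Finset.mul_sum]
      rw [Finset.sum_comm]
      refine Finset.sum_congr rfl fun i _ => Finset.sum_congr rfl fun g _ => ?_
      ring
    have horth (i : ι) : (Nat.card G : ℂ)⁻¹ *
        ∑ g : G, (V i).character g * (V j).character g⁻¹ = if i = j then 1 else 0 := by
      have := hsimple i
      have := hsimple j
      rw [FDRep.char_orthonormal]
      exact if_congr ⟨hdistinct i j, fun h => h ▸ ⟨Iso.refl _⟩⟩ rfl rfl
    simp_rw [horth] at h2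
    rw [← h1, h2]
    simp
  change _ = reg g
  rw [← hc]
  simp [hcoef]

end CompleteFamily

lemma commutatorCount_eq_sum {G : Type} [Group G] [Fintype G] [DecidableEq G] (g : G) :
    (commutatorCount G g : ℂ) =
      ∑ y : G, ∑ x : G, if x * y * x⁻¹ * y⁻¹ * g = 1 then 1 else 0 := by
  have hswap : commutatorCount G g =
      Nat.card {p : G × G // p.2 * p.1 * p.2⁻¹ * p.1⁻¹ * g = 1} := by
    refine Nat.card_congr (Equiv.subtypeEquivRight fun p => ?_)
    rw [mul_eq_one_iff_inv_eq]
    simp [mul_assoc]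
  rw [hswap, Nat.card_eq_fintype_card, Fintype.card_subtype, Finset.card_filter,
    Fintype.sum_prod_type]
  push_cast
  rfl

lemma exists_character_eq_sum_nsmul {G : Type} [Group G] {ι : Type} [Fintype ι]
    (V : ι → FDRep ℂ G) (n : ι → ℕ) :
    ∃ W : FDRep ℂ G, W.character = ∑ i, n i • (V i).character := by
  let S : AddSubmonoid (G → ℂ) :=
    { carrier := {χ | ∃ W : FDRep ℂ G, W.character = χ}
      zero_mem' := ⟨FDRep.of (1 : Representation ℂ G PUnit), by
        ext g
        exact (congrArg (LinearMap.trace ℂ PUnit) (Subsingleton.elim _ 0)).trans (map_zero _)⟩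
      add_mem' := by
        rintro _ _ ⟨W, rfl⟩ ⟨W', rfl⟩
        exact ⟨FDRep.of (Representation.prod W.ρ W'.ρ), Representation.char_prod W.ρ W'.ρ⟩ }
  exact S.sum_mem fun i _ => S.nsmul_mem ⟨V i, rfl⟩ _

/-- Frobenius: the solution count of `[x,y] = g` equals `∑_{χ ∈ Irr(G)} (|G|/χ(1)) χ(g)`,
and this function is a character of `G`. -/
theorem frobenius_commutator_count (G : Type) [Group G] [Fintype G]
    (ι : Type) [Fintype ι] (V : ι → FDRep ℂ G)
    (hsimple : ∀ i, Simple (V i))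
    (hdistinct : ∀ i j, Nonempty (V i ≅ V j) → i = j)
    (hcomplete : ∀ W : FDRep ℂ G, Simple W → ∃ i, Nonempty (W ≅ V i)) :
    (∀ g : G, (commutatorCount G g : ℂ) =
        ∑ i, ((Nat.card G : ℂ) / (V i).character 1) * (V i).character g) ∧
      ∃ W : FDRep ℂ G, ∀ g : G, W.character g = (commutatorCount G g : ℂ) := by
  classical
  have hd (i : ι) : (Module.finrank ℂ (V i) : ℂ) ≠ 0 :=
    have := hsimple i
    (V i).finrank_ne_zero_of_simple
  have htrace (i : ι) (g : G) : ∑ y : G, ∑ x : G, (V i).character (x * y * x⁻¹ * y⁻¹ * g) =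
      (Nat.card G / Module.finrank ℂ (V i) : ℂ) ^ 2 * (V i).character g := by
    have := hsimple i
    have h := congrArg (fun T => LinearMap.trace ℂ (V i) (T * (V i).ρ g)) (V i).sum_commutator_ρ
    simpa only [Finset.sum_mul, map_sum, ← map_mul, smul_mul_assoc, one_mul, map_smul,
      smul_eq_mul] using! h
  have hcount (g : G) : (commutatorCount G g : ℂ) =
      ∑ i, ((Nat.card G : ℂ) / (V i).character 1) * (V i).character g := by
    have hN : (Nat.card G : ℂ) ≠ 0 := NeZero.ne _
    refine mul_left_cancel₀ hN ?_
    calc (Nat.card G : ℂ) * commutatorCount G g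
        = ∑ y : G, ∑ x : G, ∑ i, (Module.finrank ℂ (V i) : ℂ) *
            (V i).character (x * y * x⁻¹ * y⁻¹ * g) := by
          simp_rw [sum_finrank_mul_char hsimple hdistinct hcomplete, commutatorCount_eq_sum,
            Finset.mul_sum, mul_ite, mul_one, mul_zero]
      _ = ∑ i, (Module.finrank ℂ (V i) : ℂ) *
            ∑ y : G, ∑ x : G, (V i).character (x * y * x⁻¹ * y⁻¹ * g) := by
          simp_rw [Finset.mul_sum]
          rw [Finset.sum_comm' (t' := Finset.univ) (s' := fun _ => Finset.univ) (by simp)]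
          rw [Finset.sum_congr rfl fun _ _ => Finset.sum_comm, Finset.sum_comm]
          exact Finset.sum_congr rfl fun _ _ => Finset.sum_comm
      _ = _ := by
          rw [Finset.mul_sum]
          refine Finset.sum_congr rfl fun i _ => ?_
          rw [htrace, FDRep.char_one]
          have := hd i
          field_simp
  refine ⟨hcount, ?_⟩
  obtain ⟨W, hW⟩ := exists_character_eq_sum_nsmul V
    fun i => Nat.card G / Module.finrank ℂ (V i)
  refine ⟨W, fun g => ?_⟩
  rw [hcount, hW, Finset.sum_apply]
  refine Finset.sum_congr rfl fun i _ => ?_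
  have := hsimple i
  rw [Pi.smul_apply, nsmul_eq_mul, Nat.cast_div (V i).finrank_dvd_card (hd i), FDRep.char_one]
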